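/- Let I_n ⊂ ℤ[x_1, …, x_n] be the ideal generated by all symmetric polynomials with zero constant term. The images of the Schubert polynomials 𝔖_w for w ∈ S_n form a ℤ-basis of the coinvariant algebra ℤ[x_1, …, x_n]/I_n; in particular, ℤ[x_1, …, x_n]/I_n is a free ℤ-module of rank n!. -/

import Mathlib

open MvPolynomial
open scoped Classical

/-- The polynomial ring ℤ[x₁,x₂,…]: the variable with index `i : ℕ` represents `x_{i+1}`. -/
abbrev PolyRing : Type := MvPolynomial ℕ ℤ

/-- The action of the simple transposition `s_{i+1}` on ℤ[x₁,x₂,…]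
(exchanging the variables `x_{i+1}` and `x_{i+2}` and fixing all others). -/
noncomputable def sAct (i : ℕ) (f : PolyRing) : PolyRing :=
  rename (Equiv.swap i (i + 1)) f

/-- The divided difference operator `∂_{i+1}`: the unique polynomial `g` with
`(x_{i+1} - x_{i+2}) * g = f - s_{i+1} f` (it exists, and is unique since the
polynomial ring is a domain). -/
noncomputable def divDiff (i : ℕ) (f : PolyRing) : PolyRing :=
  if h : ∃ g : PolyRing, (X i - X (i + 1)) * g = f - sAct i f then h.choose else 0

/-- Composite divided difference operator `∂_{a₁} ∘ ∂_{a₂} ∘ ⋯ ∘ ∂_{a_k}` along a word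
`a = [a₁, a₂, …, a_k]` (so `∂_{a_k}` is applied first). -/
noncomputable def divDiffWord (a : List ℕ) (f : PolyRing) : PolyRing :=
  a.foldr divDiff f

/-- The length `ℓ(w)` (number of inversions) of a permutation of `{1,2,…}`
(indices shifted down by one, so positions are indexed by `ℕ`). -/
noncomputable def len (w : Equiv.Perm ℕ) : ℕ :=
  Set.ncard {p : ℕ × ℕ | p.1 < p.2 ∧ w p.2 < w p.1}

/-- `a = [a₁, …, a_k]` is a reduced word for `w`: the product of the corresponding simple
transpositions `s_{a₁} s_{a₂} ⋯ s_{a_k}` is `w` and `k = ℓ(w)`, the number of inversions. -/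
def IsReducedWord (w : Equiv.Perm ℕ) (a : List ℕ) : Prop :=
  (a.map fun i => Equiv.swap i (i + 1)).prod = w ∧ a.length = len w

/-- The longest element `w₀` of `S_n` (reversing the first `n` positions, with positions
indexed by `ℕ` starting at `0`). -/
def wZero (n : ℕ) : Equiv.Perm ℕ :=
  Function.Involutive.toPerm (fun i => if i < n then n - 1 - i else i) (by
    intro i
    dsimp only
    split_ifs <;> omega)

/-- The staircase monomial `x₁^{n-1} x₂^{n-2} ⋯ x_{n-1}`, the Schubert polynomial of `w₀`. -/
noncomputable def staircase (n : ℕ) : PolyRing :=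
  ∏ i ∈ Finset.range n, X i ^ (n - 1 - i)

/-- The Schubert polynomial of `w` computed inside `S_n`:
`𝔖_w = ∂_{a₁} ∂_{a₂} ⋯ ∂_{a_k} 𝔖_{w₀}` for a reduced word `w⁻¹ w₀ = s_{a₁} s_{a₂} ⋯ s_{a_k}`
(any choice of reduced word gives the same answer). -/
noncomputable def schubertIn (n : ℕ) (w : Equiv.Perm ℕ) : PolyRing :=
  if h : ∃ a : List ℕ, IsReducedWord (w⁻¹ * wZero n) a then divDiffWord h.choose (staircase n)
  else 0

/-- The Schubert polynomial `𝔖_w` of a finitely supported permutation `w ∈ S_∞`, computed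
inside any `S_n` containing `w` (independent of all choices). -/
noncomputable def schubert (w : Equiv.Perm ℕ) : PolyRing :=
  if h : ∃ n : ℕ, ∀ i, w i ≠ i → i < n then schubertIn h.choose w else 0

/-- The projection ℤ[x₁,x₂,…] → ℤ[x₁,…,x_n], sending `x_i` to `x_i` for `i ≤ n` and to `0`
for `i > n` (variables of ℤ[x₁,…,x_n] are indexed by `Fin n`). -/
noncomputable def toFinVars (n : ℕ) : PolyRing →+* MvPolynomial (Fin n) ℤ :=
  (aeval fun i : ℕ => if h : i < n then (X (⟨i, h⟩ : Fin n) : MvPolynomial (Fin n) ℤ)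
    else 0).toRingHom

/-- The ideal `I_n ⊂ ℤ[x₁,…,x_n]` generated by all symmetric polynomials with zero
constant term. -/
noncomputable def symIdeal (n : ℕ) : Ideal (MvPolynomial (Fin n) ℤ) :=
  Ideal.span {f : MvPolynomial (Fin n) ℤ | f.IsSymmetric ∧ constantCoeff f = 0}


/-- Simple transposition. -/
abbrev sw (i : ℕ) : Equiv.Perm ℕ := Equiv.swap i (i + 1)

theorem dd_exists (i : ℕ) (f : PolyRing) :
    ∃ g : PolyRing, (X i - X (i + 1)) * g = f - sAct i f := by
  unfold sAct
  induction f using MvPolynomial.induction_on with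
  | C a => exact ⟨0, by simp⟩
  | add p q hp hq =>
    obtain ⟨g, hg⟩ := hp
    obtain ⟨h, hh⟩ := hq
    exact ⟨g + h, by rw [map_add]; linear_combination hg + hh⟩
  | mul_X p k hp =>
    obtain ⟨g, hg⟩ := hp
    have hX : ∃ h : PolyRing, (X i - X (i + 1)) * h =
        X k - rename (Equiv.swap i (i + 1)) (X k : PolyRing) := by
      rw [rename_X]
      by_cases h1 : k = i
      · subst h1
        exact ⟨1, by rw [Equiv.swap_apply_left]; ring⟩
      · by_cases h2 : k = i + 1
        · subst h2
          exact ⟨-1, by rw [Equiv.swap_apply_right]; ring⟩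
        · exact ⟨0, by rw [Equiv.swap_apply_of_ne_of_ne h1 h2]; ring⟩
    obtain ⟨h, hh⟩ := hX
    refine ⟨g * X k + rename (Equiv.swap i (i + 1)) p * h, ?_⟩
    rw [map_mul]
    linear_combination (X k) * hg + rename (Equiv.swap i (i + 1)) p * hh

theorem dd_spec (i : ℕ) (f : PolyRing) :
    (X i - X (i + 1)) * divDiff i f = f - sAct i f := by
  unfold divDiff
  rw [dif_pos (dd_exists i f)]
  exact (dd_exists i f).choose_spec

theorem XX_ne {i j : ℕ} (h : i ≠ j) : (X i - X j : PolyRing) ≠ 0 := by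
  rw [sub_ne_zero]
  intro h'
  exact h (X_injective h')

theorem dd_unique {i : ℕ} {f g : PolyRing} (h : (X i - X (i + 1)) * g = f - sAct i f) :
    divDiff i f = g := by
  apply mul_left_cancel₀ (XX_ne (Nat.succ_ne_self i).symm)
  rw [dd_spec, h]

theorem dd_add (i : ℕ) (f g : PolyRing) : divDiff i (f + g) = divDiff i f + divDiff i g := by
  apply dd_unique
  have h1 := dd_spec i f
  have h2 := dd_spec i g
  simp only [sAct, map_add] at *
  linear_combination h1 + h2

theorem dd_zero (i : ℕ) : divDiff i 0 = 0 := by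
  apply dd_unique; simp [sAct]

theorem sAct_mul (i : ℕ) (f g : PolyRing) : sAct i (f * g) = sAct i f * sAct i g := by
  simp [sAct]

theorem sAct_sub (i : ℕ) (f g : PolyRing) : sAct i (f - g) = sAct i f - sAct i g := by
  simp [sAct]

theorem sAct_X (i k : ℕ) : sAct i (X k) = X (sw i k) := by
  simp [sAct]

theorem sAct_sAct (i : ℕ) (f : PolyRing) : sAct i (sAct i f) = f := by
  unfold sAct
  rw [rename_rename]
  have : (⇑(Equiv.swap i (i + 1)) ∘ ⇑(Equiv.swap i (i + 1))) = id := by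
    funext x; simp
  rw [this, rename_id_apply]

theorem dd_mul_inv (i : ℕ) (f g : PolyRing) (hf : sAct i f = f) :
    divDiff i (f * g) = f * divDiff i g := by
  apply dd_unique
  rw [sAct_mul, hf]
  linear_combination f * dd_spec i g

theorem sAct_dd (i : ℕ) (f : PolyRing) : sAct i (divDiff i f) = divDiff i f := by
  apply mul_left_cancel₀ (XX_ne (Nat.succ_ne_self i).symm)
  have h := congrArg (sAct i) (dd_spec i f)
  rw [sAct_mul, sAct_sub, sAct_sub, sAct_sAct, sAct_X, sAct_X, Equiv.swap_apply_left,
    Equiv.swap_apply_right] at h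
  linear_combination -h - dd_spec i f

theorem dd_of_inv (i : ℕ) (f : PolyRing) (hf : sAct i f = f) : divDiff i f = 0 := by
  apply dd_unique; rw [hf]; ring

theorem dd_dd (i : ℕ) (f : PolyRing) : divDiff i (divDiff i f) = 0 :=
  dd_of_inv i _ (sAct_dd i f)

theorem sAct_comm (i j : ℕ) (h : i + 1 < j) (f : PolyRing) :
    sAct i (sAct j f) = sAct j (sAct i f) := by
  unfold sAct
  rw [rename_rename, rename_rename]
  congr 1
  congr 1
  funext x
  simp only [Function.comp, Equiv.swap_apply_def]
  split_ifs <;> omega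

theorem sAct_braid (i : ℕ) (f : PolyRing) :
    sAct i (sAct (i+1) (sAct i f)) = sAct (i+1) (sAct i (sAct (i+1) f)) := by
  unfold sAct
  rw [rename_rename, rename_rename, rename_rename, rename_rename]
  congr 1
  congr 1
  funext x
  simp only [Function.comp, Equiv.swap_apply_def]
  split_ifs <;> omega

theorem dd_comm (i j : ℕ) (h : i + 1 < j) (f : PolyRing) :
    divDiff i (divDiff j f) = divDiff j (divDiff i f) := by
  apply mul_left_cancel₀ (XX_ne (show j ≠ j + 1 by omega))
  apply mul_left_cancel₀ (XX_ne (show i ≠ i + 1 by omega))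
  have e1 := dd_spec i (divDiff j f)
  have e2 := dd_spec j f
  have e3 := congrArg (sAct i) e2
  have f1 := dd_spec j (divDiff i f)
  have f2 := dd_spec i f
  have f3 := congrArg (sAct j) f2
  have c := sAct_comm i j h f
  have k1 : sw i j = j := Equiv.swap_apply_of_ne_of_ne (by omega) (by omega)
  have k2 : sw i (j+1) = j+1 := Equiv.swap_apply_of_ne_of_ne (by omega) (by omega)
  have k3 : sw j i = i := Equiv.swap_apply_of_ne_of_ne (by omega) (by omega)
  have k4 : sw j (i+1) = i+1 := Equiv.swap_apply_of_ne_of_ne (by omega) (by omega)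
  rw [sAct_mul, sAct_sub, sAct_sub, sAct_X, sAct_X] at e3 f3
  rw [k1, k2] at e3
  rw [k3, k4] at f3
  linear_combination (X j - X (j+1)) * e1 + e2 - e3 - (X i - X (i+1)) * f1 - f2 + f3 + c

theorem dd_braid (i : ℕ) (f : PolyRing) :
    divDiff i (divDiff (i+1) (divDiff i f)) = divDiff (i+1) (divDiff i (divDiff (i+1) f)) := by
  apply mul_left_cancel₀ (XX_ne (show i ≠ i + 1 by omega))
  apply mul_left_cancel₀ (XX_ne (show i + 1 ≠ i + 1 + 1 by omega))
  apply mul_left_cancel₀ (XX_ne (show i ≠ i + 1 + 1 by omega))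
  have kl : sw i i = i + 1 := Equiv.swap_apply_left _ _
  have kr : sw i (i+1) = i := Equiv.swap_apply_right _ _
  have kf : sw i (i+1+1) = i+1+1 := Equiv.swap_apply_of_ne_of_ne (by omega) (by omega)
  have ml : sw (i+1) (i+1) = i + 1 + 1 := Equiv.swap_apply_left _ _
  have mr : sw (i+1) (i+1+1) = i+1 := Equiv.swap_apply_right _ _
  have mf : sw (i+1) i = i := Equiv.swap_apply_of_ne_of_ne (by omega) (by omega)
  have br := sAct_braid i f
  -- left side
  have a1 := dd_spec i (divDiff (i+1) (divDiff i f))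
  have a2 := dd_spec (i+1) (divDiff i f)
  have a3 := congrArg (sAct i) a2
  have a4 := dd_spec i f
  have a5 := congrArg (sAct (i+1)) a4
  have a6 := congrArg (sAct i) a4
  have a7 := congrArg (sAct i) a5
  -- right side
  have b1 := dd_spec (i+1) (divDiff i (divDiff (i+1) f))
  have b2 := dd_spec i (divDiff (i+1) f)
  have b3 := congrArg (sAct (i+1)) b2
  have b4 := dd_spec (i+1) f
  have b5 := congrArg (sAct i) b4
  have b6 := congrArg (sAct (i+1)) b4
  have b7 := congrArg (sAct (i+1)) b5
  simp only [sAct_mul, sAct_sub, sAct_X, kl, kr, kf, ml, mr, mf, sAct_sAct] at a3 a5 a6 a7 b3 b5 b6 b7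
  have hs := sAct_dd i f
  have hs' := sAct_dd (i+1) f
  rw [hs] at a3
  rw [hs'] at b3
  generalize divDiff i f = h at *
  generalize divDiff (i+1) f = h' at *
  generalize divDiff (i+1) h = g at *
  generalize divDiff i h' = g' at *
  generalize divDiff i g = L at *
  generalize divDiff (i+1) g' = R at *
  generalize (X i : PolyRing) = x at *
  generalize (X (i+1) : PolyRing) = y at *
  generalize (X (i+1+1) : PolyRing) = z at *
  linear_combination (y - z) * (x - z) * a1 + (x - z) * a2 - (y - z) * a3 + a4 - a5 + a7
    - ((x - y) * (x - z) * b1 + (x - z) * b2 - (x - y) * b3 + b4 - b5 + b7) - br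

set_option linter.unusedSimpArgs false

/-- `w` fixes everything at or above `n`. -/
def Sn (n : ℕ) (w : Equiv.Perm ℕ) : Prop := ∀ i, n ≤ i → w i = i

theorem Sn.inv {n : ℕ} {w : Equiv.Perm ℕ} (h : Sn n w) : Sn n w⁻¹ := by
  intro i hi
  rw [Equiv.Perm.inv_eq_iff_eq, h i hi]

theorem Sn.mul {n : ℕ} {v w : Equiv.Perm ℕ} (hv : Sn n v) (h : Sn n w) : Sn n (v * w) := by
  intro i hi
  rw [Equiv.Perm.mul_apply, h i hi, hv i hi]

theorem Sn.mono {m n : ℕ} {w : Equiv.Perm ℕ} (h : Sn m w) (hmn : m ≤ n) : Sn n w :=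
  fun i hi => h i (hmn.trans hi)

theorem Sn.lt {n : ℕ} {w : Equiv.Perm ℕ} (h : Sn n w) {i : ℕ} (hi : i < n) : w i < n := by
  by_contra hc
  push Not at hc
  have := w.injective (h _ hc)
  omega

theorem Sn_sw {n i : ℕ} (h : i + 1 < n) : Sn n (sw i) := by
  intro j hj
  exact Equiv.swap_apply_of_ne_of_ne (by omega) (by omega)

theorem Sn_one (n : ℕ) : Sn n 1 := fun _ _ => rfl

theorem Sn_wZero (n : ℕ) : Sn n (wZero n) := by
  intro i hi
  show (if i < n then n - 1 - i else i) = i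
  rw [if_neg (by omega)]

theorem wZero_apply (n i : ℕ) : wZero n i = if i < n then n - 1 - i else i := rfl

theorem app_inv (w : Equiv.Perm ℕ) (i : ℕ) : w (w⁻¹ i) = i := w.apply_symm_apply i

theorem inv_app (w : Equiv.Perm ℕ) (i : ℕ) : w⁻¹ (w i) = i := w.symm_apply_apply i

theorem sw_comm {i j : ℕ} (h : i + 1 < j) (w : Equiv.Perm ℕ) :
    sw i * (sw j * w) = sw j * (sw i * w) := by
  rw [← mul_assoc, ← mul_assoc]
  congr 1
  ext x
  simp only [Equiv.Perm.mul_apply, Equiv.swap_apply_def]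
  split_ifs <;> omega

theorem sw_braid (i : ℕ) (w : Equiv.Perm ℕ) :
    sw i * (sw (i+1) * (sw i * w)) = sw (i+1) * (sw i * (sw (i+1) * w)) := by
  rw [← mul_assoc, ← mul_assoc, ← mul_assoc, ← mul_assoc]
  congr 1
  ext x
  simp only [Equiv.Perm.mul_apply, Equiv.swap_apply_def]
  split_ifs <;> omega

/-- inversion set -/
def invS (w : Equiv.Perm ℕ) : Set (ℕ × ℕ) := {p : ℕ × ℕ | p.1 < p.2 ∧ w p.2 < w p.1}

theorem len_def (w : Equiv.Perm ℕ) : len w = (invS w).ncard := rfl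

theorem Sn.invS_sub {n : ℕ} {w : Equiv.Perm ℕ} (h : Sn n w) :
    invS w ⊆ Set.Iio n ×ˢ Set.Iio n := by
  rintro ⟨p, q⟩ ⟨h1, h2⟩
  simp only [Set.mem_prod, Set.mem_Iio] at *
  by_cases hq : q < n
  · omega
  · exfalso
    rw [h q (by omega)] at h2
    by_cases hp : p < n
    · have := h.lt hp
      omega
    · rw [h p (by omega)] at h2
      omega

theorem Sn.invS_fin {n : ℕ} {w : Equiv.Perm ℕ} (h : Sn n w) : (invS w).Finite :=
  ((Set.finite_Iio n).prod (Set.finite_Iio n)).subset h.invS_sub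

theorem Sn.len_le {n : ℕ} {w : Equiv.Perm ℕ} (h : Sn n w) : len w ≤ n * n := by
  rw [len_def]
  refine (Set.ncard_le_ncard h.invS_sub ((Set.finite_Iio n).prod (Set.finite_Iio n))).trans ?_
  rw [Set.ncard_prod]
  simp

theorem len_up {n i : ℕ} {w : Equiv.Perm ℕ} (h : Sn n w) (hi : w⁻¹ i < w⁻¹ (i + 1)) :
    len (sw i * w) = len w + 1 := by
  rw [len_def, len_def]
  have hins : invS (sw i * w) = insert (w⁻¹ i, w⁻¹ (i + 1)) (invS w) := by
    ext ⟨p, q⟩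
    obtain ⟨a, rfl⟩ := w⁻¹.surjective p
    obtain ⟨b, rfl⟩ := w⁻¹.surjective q
    simp only [invS, Set.mem_ofPred_eq, Set.mem_insert_iff, Prod.mk.injEq, Equiv.Perm.mul_apply,
      app_inv, EmbeddingLike.apply_eq_iff_eq]
    by_cases hab : a = i ∧ b = i + 1
    · obtain ⟨rfl, rfl⟩ := hab
      simpa using hi
    · by_cases hab2 : b = i ∧ a = i + 1
      · obtain ⟨rfl, rfl⟩ := hab2
        constructor
        · rintro ⟨h1, h2⟩
          omega
        · rintro (⟨h1, h2⟩ | ⟨h1, h2⟩) <;> omega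
      · have : (sw i b < sw i a) ↔ b < a := by
          simp only [Equiv.swap_apply_def]
          split_ifs <;> omega
        rw [this]
        tauto
  rw [hins, Set.ncard_insert_of_notMem _ h.invS_fin]
  simp [invS]

theorem sw_sw (i : ℕ) (w : Equiv.Perm ℕ) : sw i * (sw i * w) = w := by
  rw [← mul_assoc, Equiv.swap_mul_self, one_mul]

theorem inv_sw (i j : ℕ) (w : Equiv.Perm ℕ) : (sw i * w)⁻¹ j = w⁻¹ (sw i j) := by
  rw [mul_inv_rev, Equiv.swap_inv, Equiv.Perm.mul_apply]

/-- product of a word -/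
def wp (a : List ℕ) : Equiv.Perm ℕ := (a.map sw).prod

theorem wp_nil : wp [] = 1 := rfl


theorem wp_cons (i : ℕ) (a : List ℕ) : wp (i :: a) = sw i * wp a := by
  simp [wp]

theorem wp_append (a b : List ℕ) : wp (a ++ b) = wp a * wp b := by
  simp [wp]

theorem Sn_word (a : List ℕ) : ∃ n, Sn n (wp a) := by
  induction a with
  | nil => exact ⟨0, Sn_one 0⟩
  | cons i a ih =>
    obtain ⟨n, hn⟩ := ih
    refine ⟨max n (i + 2), ?_⟩
    rw [wp_cons]
    exact (Sn_sw (by omega)).mul (hn.mono (by omega))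

theorem Sn_swmul {n i : ℕ} {w : Equiv.Perm ℕ} (h : Sn n w) : ∃ m, Sn m (sw i * w) :=
  ⟨max n (i + 2), (Sn_sw (by omega)).mul (h.mono (by omega))⟩

theorem len_down {n i : ℕ} {w : Equiv.Perm ℕ} (h : Sn n w) (hi : w⁻¹ (i + 1) < w⁻¹ i) :
    len w = len (sw i * w) + 1 := by
  obtain ⟨m, hm⟩ := Sn_swmul (i := i) h
  have := len_up (i := i) hm (by rw [inv_sw, inv_sw]; simpa using hi)
  rwa [sw_sw] at this

theorem inv_lt_or (w : Equiv.Perm ℕ) (i : ℕ) :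
    w⁻¹ i < w⁻¹ (i + 1) ∨ w⁻¹ (i + 1) < w⁻¹ i := by
  apply lt_or_gt_of_ne
  intro h
  have := w⁻¹.injective h
  omega

/-- reduced -/
def Red (a : List ℕ) : Prop := a.length = len (wp a)

theorem isReducedWord_iff (w : Equiv.Perm ℕ) (a : List ℕ) :
    IsReducedWord w a ↔ wp a = w ∧ Red a := by
  unfold IsReducedWord Red
  constructor
  · rintro ⟨h, h'⟩
    exact ⟨h, by rw [h', ← h]; rfl⟩
  · rintro ⟨h, h'⟩
    exact ⟨h, by rw [h', ← h]⟩

theorem len_wp_le (a : List ℕ) : len (wp a) ≤ a.length := by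
  induction a with
  | nil =>
    have : invS 1 = ∅ := by
      ext ⟨p, q⟩
      simp [invS]
      intro h
      omega
    simp [len_def, wp_nil, this]
  | cons i a ih =>
    obtain ⟨n, hn⟩ := Sn_word a
    rw [wp_cons, List.length_cons]
    rcases inv_lt_or (wp a) i with h | h
    · rw [len_up hn h]
      omega
    · have := len_down hn h
      omega

theorem red_nil : Red [] := by
  have := len_wp_le []
  unfold Red
  simp only [List.length_nil] at *
  omega

theorem red_cons_iff (i : ℕ) (a : List ℕ) :
    Red (i :: a) ↔ Red a ∧ (wp a)⁻¹ i < (wp a)⁻¹ (i + 1) := by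
  obtain ⟨n, hn⟩ := Sn_word a
  have hle := len_wp_le a
  unfold Red
  rw [wp_cons, List.length_cons]
  rcases inv_lt_or (wp a) i with h | h
  · rw [len_up hn h]
    constructor
    · intro h'
      exact ⟨by omega, h⟩
    · rintro ⟨h1, h2⟩
      omega
  · have := len_down hn h
    constructor
    · intro h'
      omega
    · rintro ⟨h1, h2⟩
      omega

theorem red_append_right {a b : List ℕ} (h : Red (a ++ b)) : Red b := by
  induction a with
  | nil => exact h
  | cons i a ih =>
    exact ih ((red_cons_iff _ _).1 h).1

theorem red_desc {i : ℕ} {a : List ℕ} (h : Red (i :: a)) :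
    (wp (i :: a))⁻¹ (i + 1) < (wp (i :: a))⁻¹ i := by
  have := ((red_cons_iff _ _).1 h).2
  rw [wp_cons, inv_sw, inv_sw]
  simpa using this

theorem len_wp_mul_le (a : List ℕ) (b : List ℕ) : len (wp a * wp b) ≤ a.length + len (wp b) := by
  induction a with
  | nil => simp [wp_nil]
  | cons i a ih =>
    obtain ⟨n, hn⟩ := Sn_word (a ++ b)
    rw [wp_append] at hn
    rw [wp_cons, List.length_cons, mul_assoc]
    rcases inv_lt_or (wp a * wp b) i with h | h
    · rw [len_up hn h]
      omega
    · have := len_down hn h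
      omega

theorem exists_desc {n : ℕ} {v : Equiv.Perm ℕ} (h : Sn n v) (hv : v ≠ 1) :
    ∃ i, i + 1 < n ∧ v⁻¹ (i + 1) < v⁻¹ i := by
  by_contra hc
  push Not at hc
  apply hv
  have hm : StrictMono (v⁻¹ : Equiv.Perm ℕ) := by
    apply strictMono_nat_of_lt_succ
    intro i
    rcases lt_or_ge (i + 1) n with h1 | h1
    · rcases inv_lt_or v i with h2 | h2
      · exact h2
      · have := hc i h1
        omega
    · rw [h.inv (i + 1) h1]
      rcases lt_or_ge i n with h2 | h2
      · have := h.inv.lt h2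
        omega
      · rw [h.inv i h2]
        omega
  have h1 : ∀ i, i ≤ v⁻¹ i := fun i => hm.id_le i
  have hm' : StrictMono v := by
    intro a b hab
    rw [← hm.lt_iff_lt]
    simpa using hab
  have h2 : ∀ i, i ≤ v i := fun i => hm'.id_le i
  ext i
  have := h1 (v i)
  rw [inv_app] at this
  have := h2 i
  rw [Equiv.Perm.one_apply]
  omega

theorem exists_red {n : ℕ} : ∀ (k : ℕ) (w : Equiv.Perm ℕ), len w = k → Sn n w →
    ∃ a : List ℕ, (∀ i ∈ a, i + 1 < n) ∧ wp a = w ∧ Red a := by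
  intro k
  induction k with
  | zero =>
    intro w hw hS
    by_cases h1 : w = 1
    · exact ⟨[], by simp, by rw [h1, wp_nil], red_nil⟩
    · obtain ⟨i, hi, hd⟩ := exists_desc hS h1
      have := len_down hS hd
      omega
  | succ k ih =>
    intro w hw hS
    by_cases h1 : w = 1
    · exact ⟨[], by simp, by rw [h1, wp_nil], red_nil⟩
    · obtain ⟨i, hi, hd⟩ := exists_desc hS h1
      have hl := len_down hS hd
      obtain ⟨a, ha, hp, hr⟩ := ih (sw i * w) (by omega) ((Sn_sw hi).mul hS)
      refine ⟨i :: a, ?_, ?_, ?_⟩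
      · intro j hj
        rcases List.mem_cons.1 hj with rfl | hj
        · exact hi
        · exact ha j hj
      · rw [wp_cons, hp, sw_sw]
      · rw [red_cons_iff, hp, inv_sw, inv_sw]
        exact ⟨hr, by simpa using hd⟩

theorem exists_red' {n : ℕ} {w : Equiv.Perm ℕ} (h : Sn n w) :
    ∃ a : List ℕ, (∀ i ∈ a, i + 1 < n) ∧ wp a = w ∧ Red a := exists_red _ w rfl h

theorem ddw_cons (i : ℕ) (a : List ℕ) (f : PolyRing) :
    divDiffWord (i :: a) f = divDiff i (divDiffWord a f) := rfl

theorem ddw_append (a b : List ℕ) (f : PolyRing) :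
    divDiffWord (a ++ b) f = divDiffWord a (divDiffWord b f) := by
  simp [divDiffWord]

theorem matsumoto (k : ℕ) : ∀ a b : List ℕ, a.length = k → Red a → Red b → wp a = wp b →
    ∀ f, divDiffWord a f = divDiffWord b f := by
  induction k with
  | zero =>
    intro a b hk ha hb hab f
    have : b.length = 0 := by rw [hb, ← hab, ← ha, hk]
    rw [List.length_eq_zero_iff.1 hk, List.length_eq_zero_iff.1 this]
  | succ k ih =>
    have main : ∀ i j a b, i < j → (i :: a).length = k + 1 → Red (i :: a) → Red (j :: b) →
        wp (i :: a) = wp (j :: b) → ∀ f, divDiffWord (i :: a) f = divDiffWord (j :: b) f := by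
      intro i j a b hij hk ha hb hab f
      have hkb : (j :: b).length = k + 1 := by rw [hb, ← hab, ← ha, hk]
      have da := red_desc ha
      have db := red_desc hb
      rw [← hab] at db
      have ra := ((red_cons_iff _ _).1 ha).1
      have rb := ((red_cons_iff _ _).1 hb).1
      rw [List.length_cons] at hk hkb
      have wa : wp a = sw i * wp (i :: a) := by rw [wp_cons, sw_sw]
      have wb : wp b = sw j * wp (i :: a) := by rw [hab, wp_cons, sw_sw]
      obtain ⟨n, hn⟩ : ∃ n, Sn n (wp (i :: a)) := Sn_word (i :: a)
      generalize wp (i :: a) = w at *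
      rcases Nat.lt_or_ge (i + 1) j with hlt | hge
      · -- commuting case
        have k1 : sw i j = j := Equiv.swap_apply_of_ne_of_ne (by omega) (by omega)
        have k2 : sw i (j+1) = j+1 := Equiv.swap_apply_of_ne_of_ne (by omega) (by omega)
        have k3 : sw j i = i := Equiv.swap_apply_of_ne_of_ne (by omega) (by omega)
        have k4 : sw j (i+1) = i+1 := Equiv.swap_apply_of_ne_of_ne (by omega) (by omega)
        have hc := sw_comm hlt w
        have hw' : Sn (max n (j + 2)) (sw i * (sw j * w)) :=
          (Sn_sw (by omega)).mul ((Sn_sw (by omega)).mul (hn.mono (by omega)))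
        obtain ⟨c, -, hcw, hcr⟩ := exists_red' hw'
        have r1 : Red (i :: c) := by
          rw [red_cons_iff, hcw]
          refine ⟨hcr, ?_⟩
          simp only [inv_sw, k1, k2, k3, k4, Equiv.swap_apply_left, Equiv.swap_apply_right]
          exact da
        have r2 : Red (j :: c) := by
          rw [red_cons_iff, hcw]
          refine ⟨hcr, ?_⟩
          simp only [inv_sw, k1, k2, k3, k4, Equiv.swap_apply_left, Equiv.swap_apply_right]
          exact db
        have e1 := ih a (j :: c) (by omega) ra r2 (by rw [wa, wp_cons, hcw, hc, sw_sw]) f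
        have e2 := ih b (i :: c) (by omega) rb r1 (by rw [wb, wp_cons, hcw, sw_sw]) f
        rw [ddw_cons, ddw_cons, e1, e2, ddw_cons, ddw_cons, dd_comm i j hlt]
      · obtain rfl : j = i + 1 := by omega
        have kl : sw i i = i + 1 := Equiv.swap_apply_left _ _
        have kr : sw i (i+1) = i := Equiv.swap_apply_right _ _
        have kf : sw i (i+1+1) = i+1+1 := Equiv.swap_apply_of_ne_of_ne (by omega) (by omega)
        have ml : sw (i+1) (i+1) = i + 1 + 1 := Equiv.swap_apply_left _ _
        have mr : sw (i+1) (i+1+1) = i+1 := Equiv.swap_apply_right _ _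
        have mf : sw (i+1) i = i := Equiv.swap_apply_of_ne_of_ne (by omega) (by omega)
        have hc := sw_braid i w
        have hw' : Sn (max n (i + 3)) (sw i * (sw (i+1) * (sw i * w))) :=
          (Sn_sw (by omega)).mul ((Sn_sw (by omega)).mul ((Sn_sw (by omega)).mul
            (hn.mono (by omega))))
        obtain ⟨c, -, hcw, hcr⟩ := exists_red' hw'
        have r1 : Red ((i + 1) :: i :: c) := by
          rw [red_cons_iff, red_cons_iff, wp_cons, hcw]
          refine ⟨⟨hcr, ?_⟩, ?_⟩
          · simp only [inv_sw, kl, kr, kf, ml, mr, mf]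
            exact db
          · simp only [inv_sw, kl, kr, kf, ml, mr, mf]
            exact db.trans da
        have r2 : Red (i :: (i + 1) :: c) := by
          rw [red_cons_iff, red_cons_iff, wp_cons, hcw]
          refine ⟨⟨hcr, ?_⟩, ?_⟩
          · simp only [inv_sw, kl, kr, kf, ml, mr, mf]
            exact da
          · simp only [inv_sw, kl, kr, kf, ml, mr, mf]
            exact db.trans da
        have e1 := ih a ((i + 1) :: i :: c) (by omega) ra r1
          (by rw [wa, wp_cons, wp_cons, hcw, sw_sw, sw_sw]) f
        have e2 := ih b (i :: (i + 1) :: c) (by omega) rb r2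
          (by rw [wb, wp_cons, wp_cons, hcw, hc, sw_sw, sw_sw]) f
        rw [ddw_cons, ddw_cons, e1, e2, ddw_cons, ddw_cons, ddw_cons, ddw_cons, dd_braid]
    intro a b hk ha hb hab f
    have hkb : b.length = k + 1 := by rw [hb, ← hab, ← ha, hk]
    obtain _ | ⟨i, a⟩ := a
    · simp at hk
    obtain _ | ⟨j, b⟩ := b
    · simp at hkb
    rcases lt_trichotomy i j with h | rfl | h
    · exact main i j a b h hk ha hb hab f
    · rw [ddw_cons, ddw_cons]
      congr 1
      apply ih a b (by simpa using hk) ((red_cons_iff _ _).1 ha).1 ((red_cons_iff _ _).1 hb).1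
      rw [wp_cons, wp_cons] at hab
      exact mul_left_cancel hab
    · exact (main j i b a h hkb hb ha hab.symm f).symm

theorem ddw_eq {a b : List ℕ} (ha : Red a) (hb : Red b) (h : wp a = wp b) (f : PolyRing) :
    divDiffWord a f = divDiffWord b f := matsumoto _ a b rfl ha hb h f

theorem ddw_nonred (a : List ℕ) (h : ¬ Red a) (f : PolyRing) : divDiffWord a f = 0 := by
  induction a with
  | nil => exact absurd red_nil h
  | cons i a ih =>
    rw [ddw_cons]
    by_cases ha : Red a
    · obtain ⟨n, hn⟩ : ∃ n, Sn n (wp a) := Sn_word a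
      have hd : (wp a)⁻¹ (i + 1) < (wp a)⁻¹ i := by
        rcases inv_lt_or (wp a) i with h' | h'
        · exact absurd ((red_cons_iff _ _).2 ⟨ha, h'⟩) h
        · exact h'
      obtain ⟨m, hm⟩ := Sn_swmul (i := i) hn
      obtain ⟨c, -, hc, hr⟩ := exists_red' hm
      have hr' : Red (i :: c) := by
        rw [red_cons_iff, hc, inv_sw, inv_sw]
        exact ⟨hr, by simpa using hd⟩
      rw [ddw_eq ha hr' (by rw [wp_cons, hc, sw_sw]), ddw_cons, dd_dd]
    · rw [ih ha, dd_zero]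

theorem hom_of_mul {i d : ℕ} {g h : PolyRing} (hh : h.IsHomogeneous d)
    (e : (X i - X (i + 1)) * g = h) : g.IsHomogeneous (d - 1) := by
  intro m hm
  let _ : GradedAlgebra (homogeneousSubmodule ℕ ℤ) := gradedAlgebra
  have hX : (X i - X (i + 1) : PolyRing) ∈ homogeneousSubmodule ℕ ℤ 1 :=
    Submodule.sub_mem _ (isHomogeneous_X ℤ i) (isHomogeneous_X ℤ (i + 1))
  have key := DirectSum.coe_decompose_mul_add_of_left_mem (homogeneousSubmodule ℕ ℤ)
    (j := m.degree) (b := g) hX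
  have hc : ∀ (p : PolyRing) (k : ℕ), ((DirectSum.decompose (homogeneousSubmodule ℕ ℤ) p) k :
      PolyRing) = homogeneousComponent k p := by
    intro p k
    exact decomposition.decompose'_apply p k
  rw [hc, hc, e, homogeneousComponent_of_mem hh] at key
  have hne : homogeneousComponent m.degree g ≠ 0 := by
    intro h0
    have := congrArg (coeff m) h0
    rw [coeff_homogeneousComponent] at this
    simp at this
    exact hm this
  by_cases h1 : 1 + m.degree = d
  · have h2 : Finsupp.weight 1 m = m.degree := by
      rw [Finsupp.degree_eq_weight_one]; rfl
    omega
  · rw [if_neg h1] at key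
    exact absurd key.symm (mul_ne_zero (XX_ne (Nat.succ_ne_self i).symm) hne)

theorem dd_hom {i d : ℕ} {f : PolyRing} (hf : f.IsHomogeneous d) :
    (divDiff i f).IsHomogeneous (d - 1) :=
  hom_of_mul (hf.sub (hf.rename_isHomogeneous)) (dd_spec i f)

theorem ddw_hom (a : List ℕ) {f : PolyRing} (hf : ∃ d, f.IsHomogeneous d) :
    ∃ d, (divDiffWord a f).IsHomogeneous d := by
  induction a with
  | nil => exact hf
  | cons i a ih =>
    obtain ⟨d, hd⟩ := ih
    exact ⟨_, dd_hom hd⟩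

theorem ddw_zero (a : List ℕ) : divDiffWord a 0 = 0 := by
  induction a with
  | nil => rfl
  | cons i a ih => rw [ddw_cons, ih, dd_zero]

theorem ddw_const (e : List ℕ) (he : e ≠ []) (c : ℤ) : divDiffWord e (C c) = 0 := by
  obtain ⟨e', i, rfl⟩ : ∃ e' i, e = e' ++ [i] :=
    ⟨e.dropLast, e.getLast he, (List.dropLast_append_getLast he).symm⟩
  rw [ddw_append, ddw_cons]
  change divDiffWord e' (divDiff i (C c)) = 0
  rw [dd_of_inv i _ (by simp [sAct]), ddw_zero]

theorem staircase_hom (n : ℕ) : ∃ d, (staircase n).IsHomogeneous d :=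
  ⟨_, IsHomogeneous.prod _ _ _ fun i _ => (isHomogeneous_X ℤ i).pow _⟩

/-- the descending word `n-1, …, 0` -/
def cy : ℕ → List ℕ
  | 0 => []
  | n + 1 => n :: cy n

/-- a word for the longest element -/
def wd : ℕ → List ℕ
  | 0 => []
  | n + 1 => wd n ++ cy n

theorem cy_length (n : ℕ) : (cy n).length = n := by
  induction n with
  | zero => rfl
  | succ n ih => simp [cy, ih]

theorem wp_cy (n j : ℕ) : wp (cy n) j = if j = 0 then n else if j ≤ n then j - 1 else j := by
  induction n with
  | zero =>
    simp only [cy, wp_nil, Equiv.Perm.one_apply]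
    split_ifs <;> omega
  | succ n ih =>
    simp only [cy, wp_cons, Equiv.Perm.mul_apply, ih, Equiv.swap_apply_def]
    split_ifs <;> omega

theorem wp_wd (n : ℕ) : wp (wd n) = wZero n := by
  induction n with
  | zero =>
    ext j
    simp [wd, wp_nil, wZero_apply]
  | succ n ih =>
    ext j
    simp only [wd, wp_append, ih, Equiv.Perm.mul_apply, wp_cy, wZero_apply]
    split_ifs <;> omega

/-- intermediate monomials -/
noncomputable def EE (n k : ℕ) : PolyRing :=
  ∏ i ∈ Finset.range (n + 1), X i ^ (if i < k then n - 1 - i else n - i)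

theorem EE_zero (n : ℕ) : EE n 0 = staircase (n + 1) := by
  unfold EE staircase
  apply Finset.prod_congr rfl
  intro i _
  simp

theorem EE_self (n : ℕ) : EE n n = staircase n := by
  unfold EE staircase
  rw [Finset.prod_range_succ]
  simp only [lt_irrefl, if_false, Nat.sub_self, pow_zero, mul_one]
  apply Finset.prod_congr rfl
  intro i hi
  rw [if_pos (Finset.mem_range.1 hi)]

theorem EE_step {n k : ℕ} (hk : k < n) : EE n k = EE n (k + 1) * X k := by
  have : (X k : PolyRing) = ∏ i ∈ Finset.range (n + 1), if k = i then X i else 1 := by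
    rw [Finset.prod_ite_eq, if_pos (Finset.mem_range.2 (by omega))]
  rw [this]
  unfold EE
  rw [← Finset.prod_mul_distrib]
  apply Finset.prod_congr rfl
  intro i hi
  rcases lt_trichotomy i k with h | rfl | h
  · rw [if_pos h, if_pos (by omega), if_neg (by omega), mul_one]
  · rw [if_neg (by omega), if_pos (by omega), if_pos rfl, ← pow_succ]
    congr 1
    omega
  · rw [if_neg (by omega), if_neg (by omega), if_neg (by omega), mul_one]

theorem EE_inv {n k : ℕ} (hk : k < n) : sAct k (EE n (k + 1)) = EE n (k + 1) := by
  unfold EE sAct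
  rw [map_prod]
  apply Finset.prod_equiv (sw k)
  · intro i
    simp only [Finset.mem_range, Equiv.swap_apply_def]
    split_ifs <;> omega
  · intro i hi
    rw [map_pow, rename_X]
    congr 1
    have := Finset.mem_range.1 hi
    simp only [Equiv.swap_apply_def]
    split_ifs <;> omega

theorem dd_X (k : ℕ) : divDiff k (X k) = 1 := by
  apply dd_unique
  rw [sAct_X, Equiv.swap_apply_left, mul_one]

theorem ddw_cy (n k : ℕ) (hk : k ≤ n) : divDiffWord (cy k) (staircase (n + 1)) = EE n k := by
  induction k with
  | zero => exact (EE_zero n).symm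
  | succ k ih =>
    rw [cy, ddw_cons, ih (by omega), EE_step (by omega), dd_mul_inv _ _ _ (EE_inv (by omega)),
      dd_X, mul_one]

theorem ddw_cy' (n : ℕ) : divDiffWord (cy n) (staircase (n + 1)) = staircase n := by
  rw [ddw_cy n n le_rfl, EE_self]

theorem ddw_wd (n : ℕ) : divDiffWord (wd n) (staircase n) = 1 := by
  induction n with
  | zero => simp [wd, divDiffWord, staircase]
  | succ n ih => rw [wd, ddw_append, ddw_cy', ih]

theorem red_wd (n : ℕ) : Red (wd n) := by
  by_contra h
  have := ddw_nonred _ h (staircase n)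
  rw [ddw_wd] at this
  exact one_ne_zero this

theorem exists_asc {n : ℕ} {v : Equiv.Perm ℕ} (h : Sn n v) (hv : v ≠ wZero n) :
    ∃ i, i + 1 < n ∧ v⁻¹ i < v⁻¹ (i + 1) := by
  have hw : wZero n * wZero n = 1 := by
    ext j
    simp only [Equiv.Perm.mul_apply, wZero_apply, Equiv.Perm.one_apply]
    split_ifs <;> omega
  have hinv : (wZero n)⁻¹ = wZero n := inv_eq_of_mul_eq_one_left hw
  obtain ⟨i, hi, hd⟩ := exists_desc ((Sn_wZero n).mul h) (by
    intro h1
    apply hv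
    rw [← hinv]
    exact (inv_eq_of_mul_eq_one_right h1).symm)
  rw [mul_inv_rev, hinv, Equiv.Perm.mul_apply, Equiv.Perm.mul_apply, wZero_apply, wZero_apply,
    if_pos (by omega), if_pos (by omega)] at hd
  refine ⟨n - 1 - (i + 1), by omega, ?_⟩
  convert hd using 2
  omega

theorem extend_red {n : ℕ} : ∀ (k : ℕ) (b : List ℕ), n * n - len (wp b) = k → Red b → Sn n (wp b) →
    ∃ e, Red (e ++ b) ∧ wp (e ++ b) = wZero n := by
  intro k
  induction k with
  | zero =>
    intro b hk hb hS
    by_cases hv : wp b = wZero n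
    · exact ⟨[], hb, hv⟩
    · obtain ⟨i, hi, ha⟩ := exists_asc hS hv
      have h1 := len_up hS ha
      have h2 := ((Sn_sw hi).mul hS).len_le
      omega
  | succ k ih =>
    intro b hk hb hS
    by_cases hv : wp b = wZero n
    · exact ⟨[], hb, hv⟩
    · obtain ⟨i, hi, ha⟩ := exists_asc hS hv
      have h1 := len_up hS ha
      obtain ⟨e, he, he'⟩ := ih (i :: b) (by rw [wp_cons, h1]; omega)
        ((red_cons_iff _ _).2 ⟨hb, ha⟩) (by rw [wp_cons]; exact (Sn_sw hi).mul hS)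
      exact ⟨e ++ [i], by simpa using he, by simpa using he'⟩

theorem extend_red' {n : ℕ} {b : List ℕ} (hb : Red b) (hS : Sn n (wp b)) :
    ∃ e, Red (e ++ b) ∧ wp (e ++ b) = wZero n := extend_red _ b rfl hb hS

theorem red_append_left {a b : List ℕ} (h : Red (a ++ b)) : Red a := by
  obtain ⟨n, hn⟩ := Sn_word a
  obtain ⟨e, -, he, hr⟩ := exists_red' hn
  have h1 := len_wp_mul_le e b
  rw [he, ← wp_append, ← h, List.length_append, hr, he] at h1
  have h2 := len_wp_le a
  have h3 := len_wp_le b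
  unfold Red
  omega

theorem schubertIn_eq {n : ℕ} {w : Equiv.Perm ℕ} {b : List ℕ} (hb : Red b)
    (hw : wp b = w⁻¹ * wZero n) : schubertIn n w = divDiffWord b (staircase n) := by
  have hex : ∃ a : List ℕ, IsReducedWord (w⁻¹ * wZero n) a :=
    ⟨b, (isReducedWord_iff _ _).2 ⟨hw, hb⟩⟩
  unfold schubertIn
  rw [dif_pos hex]
  have := (isReducedWord_iff _ _).1 hex.choose_spec
  exact ddw_eq this.2 hb (by rw [this.1, hw]) _

theorem schubertIn_succ {n : ℕ} {w : Equiv.Perm ℕ} (h : Sn n w) :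
    schubertIn (n + 1) w = schubertIn n w := by
  obtain ⟨b, -, hb, hr⟩ := exists_red' (h.inv.mul (Sn_wZero n))
  obtain ⟨e, he, hw⟩ := extend_red' (n := n) hr (by rw [hb]; exact h.inv.mul (Sn_wZero n))
  have hc : wZero n * wp (cy n) = wZero (n + 1) := by
    rw [← wp_wd, ← wp_append, ← wp_wd]; rfl
  have hred : Red (e ++ (b ++ cy n)) := by
    unfold Red
    rw [← List.append_assoc, wp_append, hw, hc, ← wp_wd, ← red_wd, List.length_append, he, hw,
      wd, List.length_append, red_wd, wp_wd]
  rw [schubertIn_eq (red_append_right hred) (by rw [wp_append, hb, mul_assoc, hc]),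
    schubertIn_eq hr hb, ddw_append, ddw_cy']

theorem schubertIn_le {m n : ℕ} (hmn : m ≤ n) {w : Equiv.Perm ℕ} (h : Sn m w) :
    schubertIn n w = schubertIn m w := by
  induction n, hmn using Nat.le_induction with
  | base => rfl
  | succ n hn ih => rw [schubertIn_succ (h.mono hn), ih]

theorem schubert_eq {n : ℕ} {w : Equiv.Perm ℕ} (h : Sn n w) : schubert w = schubertIn n w := by
  have hex : ∃ n : ℕ, ∀ i, w i ≠ i → i < n := by
    refine ⟨n, fun i hi => ?_⟩
    by_contra hc
    exact hi (h i (by omega))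
  unfold schubert
  rw [dif_pos hex]
  have hN : Sn hex.choose w := by
    intro i hi
    by_contra hc
    have := hex.choose_spec i hc
    omega
  rw [← schubertIn_le (le_max_left _ n) hN, ← schubertIn_le (le_max_right hex.choose n) h]

theorem duality {n : ℕ} {u w : Equiv.Perm ℕ} (hu : Sn n u) (hw : Sn n w) {a : List ℕ}
    (ha : Red a) (hau : wp a = u) :
    constantCoeff (divDiffWord a (schubert w)) = if u = w then 1 else 0 := by
  rw [schubert_eq hw]
  obtain ⟨b, -, hb, hr⟩ := exists_red' (hw.inv.mul (Sn_wZero n))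
  rw [schubertIn_eq hr hb]
  split_ifs with huw
  · subst huw
    obtain ⟨e, he, hew⟩ := extend_red' (n := n) hr (by rw [hb]; exact hw.inv.mul (Sn_wZero n))
    have he1 : wp e = u := by
      rw [wp_append, hb, ← mul_assoc] at hew
      have := mul_eq_right.1 hew
      rwa [mul_inv_eq_one] at this
    rw [ddw_eq ha (red_append_left he) (by rw [hau, he1]), ← ddw_append,
      ddw_eq he (red_wd n) (by rw [hew, wp_wd]), ddw_wd, map_one]
  · rw [← ddw_append]
    by_cases hred : Red (a ++ b)
    · by_contra hne
      obtain ⟨d, hd⟩ := ddw_hom (a ++ b) (staircase_hom n)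
      obtain ⟨e, he, hew⟩ := extend_red' (n := n) hred (by
        rw [wp_append, hau, hb]; exact hu.mul (hw.inv.mul (Sn_wZero n)))
      have hnil : e ≠ [] := by
        rintro rfl
        rw [List.nil_append, wp_append, hau, hb, ← mul_assoc] at hew
        have := mul_eq_right.1 hew
        rw [mul_inv_eq_one] at this
        exact huw this
      have h1 := ddw_eq he (red_wd n) (by rw [hew, wp_wd]) (staircase n)
      rw [ddw_wd, ddw_append] at h1
      have hd0 : d = 0 := by
        have := hd (d := 0) (by rwa [← constantCoeff_eq])
        simpa using this.symm
      subst hd0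
      rw [totalDegree_eq_zero_iff_eq_C.1 (Nat.le_zero.1 hd.totalDegree_le), ddw_const _ hnil] at h1
      exact zero_ne_one h1
    · rw [ddw_nonred _ hred, map_zero]

theorem ddw_add (a : List ℕ) (f g : PolyRing) :
    divDiffWord a (f + g) = divDiffWord a f + divDiffWord a g := by
  induction a with
  | nil => rfl
  | cons i a ih => rw [ddw_cons, ih, dd_add]; rfl

/-- embedding of the polynomial ring in `n` variables -/
noncomputable def emb (n : ℕ) : MvPolynomial (Fin n) ℤ →ₐ[ℤ] PolyRing := rename Fin.val

theorem emb_proj_sAct {n i : ℕ} (hi : i + 1 < n) (f : PolyRing) :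
    sAct i (emb n (toFinVars n f)) = emb n (toFinVars n (sAct i f)) := by
  unfold sAct
  induction f using MvPolynomial.induction_on with
  | C a => simp [toFinVars, emb]
  | add p q hp hq => simp only [map_add, hp, hq]
  | mul_X p k hp =>
    simp only [map_mul, hp]
    congr 1
    simp only [toFinVars, emb, rename_X, AlgHom.toRingHom_eq_coe, RingHom.coe_coe, aeval_X]
    by_cases hk : k < n
    · have h2 : sw i k < n := (Sn_sw hi).lt hk
      rw [dif_pos hk, dif_pos h2, rename_X, rename_X, rename_X]
    · have h2 : sw i k = k := Sn_sw hi k (by omega)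
      rw [dif_neg hk, dif_neg (by rw [h2]; exact hk)]
      simp

theorem emb_proj_dd {n i : ℕ} (hi : i + 1 < n) (f : PolyRing) :
    divDiff i (emb n (toFinVars n f)) = emb n (toFinVars n (divDiff i f)) := by
  apply dd_unique
  have h := congrArg (fun g => emb n (toFinVars n g)) (dd_spec i f)
  simp only [map_sub, map_mul] at h
  rw [emb_proj_sAct hi, ← h]
  congr 2
  · simp [toFinVars, emb, show i < n by omega]
  · simp [toFinVars, emb, show i + 1 < n by omega]

theorem emb_proj_ddw {n : ℕ} (a : List ℕ) (ha : ∀ i ∈ a, i + 1 < n) (f : PolyRing) :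
    divDiffWord a (emb n (toFinVars n f)) = emb n (toFinVars n (divDiffWord a f)) := by
  induction a with
  | nil => rfl
  | cons i a ih =>
    rw [ddw_cons, ddw_cons, ih (fun j hj => ha j (List.mem_cons_of_mem _ hj)),
      emb_proj_dd (ha i List.mem_cons_self)]

theorem cc_emb (n : ℕ) (f : MvPolynomial (Fin n) ℤ) :
    constantCoeff (emb n f) = constantCoeff f := by
  unfold emb
  rw [constantCoeff_rename]

theorem cc_proj (n : ℕ) (f : PolyRing) : constantCoeff (toFinVars n f) = constantCoeff f := by
  induction f using MvPolynomial.induction_on with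
  | C a => simp [toFinVars]
  | add p q hp hq => simp only [map_add, hp, hq]
  | mul_X p k hp =>
    simp only [map_mul, hp, constantCoeff_X, mul_zero]
    simp only [toFinVars, AlgHom.toRingHom_eq_coe, RingHom.coe_coe, aeval_X]
    split_ifs <;> simp

theorem emb_sym {n i : ℕ} (hi : i + 1 < n) {f : MvPolynomial (Fin n) ℤ} (hf : f.IsSymmetric) :
    sAct i (emb n f) = emb n f := by
  have h := hf (Equiv.swap ⟨i, by omega⟩ ⟨i + 1, hi⟩)
  conv_rhs => rw [← h]
  unfold sAct emb
  rw [rename_rename, rename_rename]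
  congr 2
  funext x
  simp only [Function.comp, Equiv.swap_apply_def, Fin.ext_iff]
  split_ifs <;> rfl

theorem ddw_mul_sym {n : ℕ} (a : List ℕ) (ha : ∀ i ∈ a, i + 1 < n)
    {f : MvPolynomial (Fin n) ℤ} (hf : f.IsSymmetric) (g : PolyRing) :
    divDiffWord a (emb n f * g) = emb n f * divDiffWord a g := by
  induction a with
  | nil => rfl
  | cons i a ih =>
    rw [ddw_cons, ddw_cons, ih (fun j hj => ha j (List.mem_cons_of_mem _ hj)),
      dd_mul_inv _ _ _ (emb_sym (ha i List.mem_cons_self) hf)]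

/-- the functional attached to a word -/
noncomputable def phi (n : ℕ) (a : List ℕ) : MvPolynomial (Fin n) ℤ →+ ℤ where
  toFun f := constantCoeff (divDiffWord a (emb n f))
  map_zero' := by rw [map_zero, ddw_zero, map_zero]
  map_add' f g := by rw [map_add, ddw_add, map_add]

theorem phi_ideal {n : ℕ} (a : List ℕ) (ha : ∀ i ∈ a, i + 1 < n) {f : MvPolynomial (Fin n) ℤ}
    (hf : f ∈ symIdeal n) : phi n a f = 0 := by
  have : ∀ g, phi n a (f * g) = 0 := by
    unfold symIdeal at hf
    induction hf using Submodule.span_induction with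
    | mem x hx =>
      intro g
      change constantCoeff (divDiffWord a (emb n (x * g))) = 0
      rw [map_mul, ddw_mul_sym a ha hx.1, map_mul, cc_emb, hx.2, zero_mul]
    | zero => intro g; rw [zero_mul, map_zero]
    | add x y _ _ hx hy => intro g; rw [add_mul, map_add, hx, hy, add_zero]
    | smul r x _ hx =>
      intro g
      rw [smul_eq_mul, mul_comm r x, mul_assoc]
      exact hx _
  simpa using this 1

theorem phi_quot {n : ℕ} (a : List ℕ) (ha : ∀ i ∈ a, i + 1 < n) :
    ∃ F : (MvPolynomial (Fin n) ℤ ⧸ symIdeal n) →ₗ[ℤ] ℤ,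
      ∀ f, F (Ideal.Quotient.mk (symIdeal n) f) = phi n a f := by
  let F0 : (MvPolynomial (Fin n) ℤ ⧸ symIdeal n) → ℤ :=
    fun q => phi n a (Function.surjInv Ideal.Quotient.mk_surjective q)
  have hF : ∀ f, F0 (Ideal.Quotient.mk (symIdeal n) f) = phi n a f := by
    intro f
    have h1 := Function.surjInv_eq (Ideal.Quotient.mk_surjective (I := symIdeal n))
      (Ideal.Quotient.mk (symIdeal n) f)
    rw [Ideal.Quotient.eq] at h1
    have := phi_ideal a ha h1
    rw [map_sub, sub_eq_zero] at this
    exact this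
  let F1 : (MvPolynomial (Fin n) ℤ ⧸ symIdeal n) →+ ℤ := AddMonoidHom.mk' F0 (by
    intro x y
    obtain ⟨f, rfl⟩ := Ideal.Quotient.mk_surjective x
    obtain ⟨g, rfl⟩ := Ideal.Quotient.mk_surjective y
    rw [← map_add, hF, hF, hF, map_add])
  exact ⟨F1.toIntLinearMap, hF⟩

theorem Sn_ext {n : ℕ} (w : Equiv.Perm (Fin n)) :
    Sn n (w.extendDomain (Fin.equivSubtype (n := n))) := by
  intro i hi
  exact Equiv.Perm.extendDomain_apply_not_subtype _ _ (by omega)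

theorem phi_dual (n : ℕ) (u : Equiv.Perm (Fin n)) :
    ∃ F : (MvPolynomial (Fin n) ℤ ⧸ symIdeal n) →ₗ[ℤ] ℤ, ∀ w : Equiv.Perm (Fin n),
      F (Ideal.Quotient.mk (symIdeal n)
          (toFinVars n (schubert (w.extendDomain (Fin.equivSubtype (n := n)))))) =
        if u = w then 1 else 0 := by
  obtain ⟨a, ha, hp, hr⟩ := exists_red' (Sn_ext u)
  obtain ⟨F, hF⟩ := phi_quot a ha
  refine ⟨F, fun w => ?_⟩
  rw [hF]
  change constantCoeff (divDiffWord a (emb n _)) = _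
  rw [emb_proj_ddw a ha, cc_emb, cc_proj, duality (Sn_ext u) (Sn_ext w) hr hp]
  have : (u.extendDomain (Fin.equivSubtype (n := n)) =
      w.extendDomain (Fin.equivSubtype (n := n))) ↔ u = w :=
    (Equiv.Perm.extendDomainHom_injective (Fin.equivSubtype (n := n))).eq_iff
  simp only [this]

open Polynomial in
theorem span_tower (m : ℕ) : ∀ (S A : Type) [CommRing S] [CommRing A] [Algebra S A]
    (x : Fin m → A), Algebra.adjoin S (Set.range x) = ⊤ →
    (∃ p : S[X], p.Monic ∧ p.map (algebraMap S A) = ∏ i, (Polynomial.X - Polynomial.C (x i))) →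
    ∃ s : Finset A, s.card ≤ m.factorial ∧ Submodule.span S (s : Set A) = ⊤ := by
  induction m with
  | zero =>
    intro S A _ _ _ x hx _
    refine ⟨{1}, by simp, ?_⟩
    rw [Set.range_eq_empty, Algebra.adjoin_empty] at hx
    rw [Finset.coe_singleton, ← Submodule.one_eq_span, ← Algebra.toSubmodule_bot, hx,
      Algebra.top_toSubmodule]
  | succ m ih =>
    rintro S A _ _ _ x hx ⟨p, hp, hpx⟩
    by_cases hnt : Nontrivial A
    swap
    · rw [not_nontrivial_iff_subsingleton] at hnt
      exact ⟨∅, by simp, Subsingleton.elim _ _⟩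
    have hntS : Nontrivial S := (algebraMap S A).domain_nontrivial
    have hdeg : p.natDegree = m + 1 := by
      rw [← hp.natDegree_map (algebraMap S A), hpx, natDegree_prod_of_monic _ _
        (fun i _ => monic_X_sub_C _)]
      simp
    let S' := Algebra.adjoin S {x 0}
    let y : S' := ⟨x 0, Algebra.subset_adjoin rfl⟩
    have hroot : aeval (x 0) p = 0 := by
      rw [Polynomial.aeval_def, Polynomial.eval₂_eq_eval_map, hpx, Polynomial.eval_prod]
      exact Finset.prod_eq_zero (Finset.mem_univ 0) (by simp)
    have hrooty : (p.map (algebraMap S S')).IsRoot y := by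
      rw [IsRoot.def, Polynomial.eval_map, ← Polynomial.aeval_def]
      apply Subtype.ext
      have := aeval_algebraMap_apply A y p
      change algebraMap S' A _ = 0
      rw [← this]
      exact hroot
    obtain ⟨q, hq⟩ := dvd_iff_isRoot.2 hrooty
    have hqm : q.Monic := by
      have h1 : ((Polynomial.X - Polynomial.C y) * q).Monic := by rw [← hq]; exact hp.map _
      exact (monic_X_sub_C y).of_mul_monic_left h1
    have hqx : q.map (algebraMap S' A) =
        ∏ i : Fin m, (Polynomial.X - Polynomial.C (x i.succ)) := by
      have h1 := congrArg (Polynomial.map (algebraMap S' A)) hq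
      rw [Polynomial.map_map, ← IsScalarTower.algebraMap_eq, hpx, Fin.prod_univ_succ,
        Polynomial.map_mul, Polynomial.map_sub, Polynomial.map_X, Polynomial.map_C] at h1
      exact ((monic_X_sub_C (x 0)).isRegular.left h1).symm
    have hx' : Algebra.adjoin S' (Set.range fun i : Fin m => x i.succ) = ⊤ := by
      rw [eq_top_iff]
      intro z _
      have hz : z ∈ Algebra.adjoin S (Set.range x) := by rw [hx]; trivial
      induction hz using Algebra.adjoin_induction with
      | mem z hz =>
        obtain ⟨i, rfl⟩ := hz
        refine Fin.cases ?_ (fun j => ?_) i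
        · exact (Algebra.adjoin S' _).algebraMap_mem y
        · exact Algebra.subset_adjoin ⟨j, rfl⟩
      | algebraMap r =>
        rw [IsScalarTower.algebraMap_apply S S' A]
        exact (Algebra.adjoin S' _).algebraMap_mem _
      | add a b _ _ ha hb => exact add_mem (ha trivial) (hb trivial)
      | mul a b _ _ ha hb => exact mul_mem (ha trivial) (hb trivial)
    obtain ⟨t, ht, htspan⟩ := ih S' A (fun i => x i.succ) hx' ⟨q, hqm, hqx⟩
    -- powers of `y` span `S'`
    have hs : Submodule.span S (((Finset.range (m + 1)).image (fun i => y ^ i) : Finset S') :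
        Set S') = ⊤ := by
      rw [eq_top_iff]
      rintro ⟨z, hz⟩ -
      obtain ⟨r, rfl⟩ : ∃ r : S[X], aeval (x 0) r = z := by
        have := Algebra.adjoin_singleton_eq_range_aeval S (x 0)
        have hz' : z ∈ Algebra.adjoin S {x 0} := hz
        rw [this] at hz'
        exact hz'
      have hr : aeval y (r %ₘ p) = (⟨aeval (x 0) r, hz⟩ : S') := by
        apply Subtype.ext
        change algebraMap S' A _ = _
        rw [← Polynomial.aeval_algebraMap_apply A y]
        change aeval (x 0) (r %ₘ p) = aeval (x 0) r
        exact aeval_modByMonic_eq_self_of_root hroot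
      rw [← hr, aeval_eq_sum_range' (n := m + 1)]
      · refine Submodule.sum_mem _ fun i hi => Submodule.smul_mem _ _ (Submodule.subset_span ?_)
        rw [Finset.coe_image]
        exact ⟨i, hi, rfl⟩
      · rw [← hdeg]
        apply natDegree_modByMonic_lt _ hp
        intro h1
        rw [h1] at hdeg
        simp at hdeg
    have hfin := Submodule.span_smul_of_span_eq_top hs (t : Set A)
    rw [htspan, Submodule.restrictScalars_top] at hfin
    refine ⟨Finset.image₂ (fun (a : S') (b : A) => a • b)
      ((Finset.range (m + 1)).image (fun i => y ^ i)) t, ?_, ?_⟩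
    · refine (Finset.card_image₂_le _ _ _).trans ?_
      rw [Nat.factorial_succ]
      refine Nat.mul_le_mul ?_ ht
      exact Finset.card_image_le.trans (by simp)
    · rw [Finset.coe_image₂]
      exact hfin

open Polynomial in
theorem quot_span (n : ℕ) : ∃ s : Finset (MvPolynomial (Fin n) ℤ ⧸ symIdeal n),
    s.card ≤ n.factorial ∧ Submodule.span ℤ (s : Set (MvPolynomial (Fin n) ℤ ⧸ symIdeal n)) = ⊤ := by
  apply span_tower n ℤ _ (fun i => -Ideal.Quotient.mk (symIdeal n) (MvPolynomial.X i))
  · rw [eq_top_iff]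
    intro z _
    obtain ⟨f, rfl⟩ := Ideal.Quotient.mk_surjective z
    induction f using MvPolynomial.induction_on with
    | C a =>
      exact (Algebra.adjoin ℤ _).algebraMap_mem a
    | add p q hp hq => rw [map_add]; exact add_mem (hp trivial) (hq trivial)
    | mul_X p k hp =>
      rw [map_mul]
      refine mul_mem (hp trivial) ?_
      rw [← neg_neg (Ideal.Quotient.mk (symIdeal n) (MvPolynomial.X k))]
      exact neg_mem (Algebra.subset_adjoin ⟨k, rfl⟩)
  · refine ⟨Polynomial.X ^ n, monic_X_pow n, ?_⟩
    rw [Polynomial.map_pow, Polynomial.map_X]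
    have hz : ∀ j, 0 < j → Ideal.Quotient.mk (symIdeal n) (esymm (Fin n) ℤ j) = 0 := by
      intro j hj
      rw [Ideal.Quotient.eq_zero_iff_mem]
      apply Ideal.subset_span
      refine ⟨esymm_isSymmetric _ _ _, ?_⟩
      rw [esymm, map_sum]
      apply Finset.sum_eq_zero
      intro t ht
      rw [Finset.mem_powersetCard] at ht
      obtain ⟨i, hi⟩ := Finset.card_pos.1 (by omega : 0 < t.card)
      rw [map_prod]
      exact Finset.prod_eq_zero hi (by simp)
    have hv := MvPolynomial.prod_C_add_X_eq_sum_esymm ℤ (Fin n)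
    have hv' := congrArg (Polynomial.map (Ideal.Quotient.mk (symIdeal n))) hv
    simp only [Polynomial.map_sum, Polynomial.map_mul, Polynomial.map_C, Polynomial.map_pow,
      Polynomial.map_X, Polynomial.map_prod, Polynomial.map_add, Fintype.card_fin] at hv'
    rw [Finset.sum_range_succ', Finset.sum_eq_zero (fun j _ => by
      rw [hz (j + 1) (by omega), Polynomial.C_0, zero_mul])] at hv'
    simp only [esymm_zero, map_one, one_mul, zero_add, Nat.sub_zero] at hv'
    rw [← hv']
    apply Finset.prod_congr rfl
    intro i _
    rw [Polynomial.C_neg, sub_neg_eq_add]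

theorem final_la {ι A : Type} [Fintype ι] [DecidableEq ι] [Nonempty ι] [CommRing A] (b : ι → A)
    (F : ι → A →ₗ[ℤ] ℤ) (hF : ∀ u w, F u (b w) = if u = w then 1 else 0)
    (s : Finset A) (hs : s.card ≤ Fintype.card ι) (hspan : Submodule.span ℤ (s : Set A) = ⊤) :
    (LinearIndependent ℤ b ∧ Submodule.span ℤ (Set.range b) = ⊤) ∧ Module.Free ℤ A ∧
      Module.rank ℤ A = Fintype.card ι := by
  let Φ : A →ₗ[ℤ] (ι → ℤ) := LinearMap.pi F
  have hΦ : ∀ w, Φ (b w) = Pi.single w 1 := by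
    intro w
    funext u
    simp only [Φ, LinearMap.pi_apply, hF, Pi.single_apply]
  have hsurj : Function.Surjective Φ := by
    intro v
    refine ⟨∑ w, v w • b w, ?_⟩
    rw [map_sum]
    funext u
    simp only [map_smul, hΦ, Finset.sum_apply, Pi.smul_apply, Pi.single_apply]
    simp
  obtain ⟨g⟩ : Nonempty (s ↪ ι) := by
    apply Function.Embedding.nonempty_of_card_le
    simpa using hs
  let v : ι → A := Function.extend g (fun x : s => (x : A)) 0
  have hg : Function.Surjective (Fintype.linearCombination ℤ v) := by
    rw [← LinearMap.range_eq_top, Fintype.range_linearCombination, eq_top_iff, ← hspan]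
    apply Submodule.span_mono
    intro x hx
    exact ⟨g ⟨x, hx⟩, by simp only [v]; rw [g.injective.extend_apply]⟩
  have hcomp : Function.Injective (Φ ∘ₗ Fintype.linearCombination ℤ v) :=
    OrzechProperty.injective_of_surjective_endomorphism _ (hsurj.comp hg)
  have hinj : Function.Injective Φ := by
    intro x y hxy
    obtain ⟨x, rfl⟩ := hg x
    obtain ⟨y, rfl⟩ := hg y
    rw [hcomp hxy]
  let B : Module.Basis ι ℤ A := Module.Basis.ofEquivFun (LinearEquiv.ofBijective Φ ⟨hinj, hsurj⟩)
  have hB : ⇑B = b := by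
    funext w
    rw [Module.Basis.coe_ofEquivFun]
    rw [LinearEquiv.symm_apply_eq]
    exact (hΦ w).symm
  refine ⟨⟨hB ▸ B.linearIndependent, hB ▸ B.span_eq⟩, Module.Free.of_basis B, ?_⟩
  rw [rank_eq_card_basis B]

/-- The images of the Schubert polynomials `𝔖_w`, `w ∈ S_n`, form a ℤ-basis of
the coinvariant algebra `ℤ[x₁,…,x_n]/I_n`; in particular `ℤ[x₁,…,x_n]/I_n` is a free ℤ-module
of rank `n!`.  (Here `S_n = Equiv.Perm (Fin n)` is included into the permutations of `ℕ` via
`Equiv.Perm.extendDomain`.) -/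
theorem coinvariant_basis (n : ℕ) :
    (LinearIndependent ℤ (fun w : Equiv.Perm (Fin n) =>
        Ideal.Quotient.mk (symIdeal n)
          (toFinVars n (schubert (w.extendDomain (Fin.equivSubtype (n := n)))))) ∧
      Submodule.span ℤ (Set.range fun w : Equiv.Perm (Fin n) =>
        Ideal.Quotient.mk (symIdeal n)
          (toFinVars n (schubert (w.extendDomain (Fin.equivSubtype (n := n)))))) = ⊤) ∧
    Module.Free ℤ (MvPolynomial (Fin n) ℤ ⧸ symIdeal n) ∧
    Module.rank ℤ (MvPolynomial (Fin n) ℤ ⧸ symIdeal n) = Nat.factorial n := by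
  choose F hF using phi_dual n
  obtain ⟨s, hs, hspan⟩ := quot_span n
  have hcard : Fintype.card (Equiv.Perm (Fin n)) = n.factorial := by
    rw [Fintype.card_perm, Fintype.card_fin]
  have := final_la _ F hF s (by rw [hcard]; exact hs) hspan
  rwa [hcard] at this
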